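/- Let (Y,d_Y) be an NPC space, let P, Q, R, S be any four points of Y, and let Q_m be the midpoint of a geodesic from Q to R. Writing d_{AB} := d_Y(A,B), one has (d_{PS} − d_{QR})·d_{QR} ≥ (d²_{PQ_m} − d²_{PQ} − d²_{Q_mQ}) + (d²_{SQ_m} − d²_{SR} − d²_{Q_mR}). -/

import Mathlib

open MeasureTheory Metric Filter Set Asymptotics
open scoped Topology ENNReal NNReal

noncomputable section

namespace Paper

/-- A unit-speed geodesic of length `L`. -/
def IsUnitGeodesic {M : Type*} [MetricSpace M] (γ : ℝ → M) (L : ℝ) : Prop :=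
  0 ≤ L ∧ ∀ s ∈ Set.Icc (0:ℝ) L, ∀ t ∈ Set.Icc (0:ℝ) L, dist (γ s) (γ t) = |s - t|

/-- A geodesic metric space: every pair of points is joined by a unit-speed
shortest geodesic. -/
def GeodesicSpace (M : Type*) [MetricSpace M] : Prop :=
  ∀ x y : M, ∃ γ : ℝ → M, IsUnitGeodesic γ (dist x y) ∧ γ 0 = x ∧ γ (dist x y) = y

/-- The comparison angle `∠̃_k` in the model plane `𝕄²_k` at the vertex between two
sides of lengths `a`, `b` whose opposite side has length `c`, given by the law of
cosines in the model plane of constant curvature `k`. -/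
def cmpAngle (k a b c : ℝ) : ℝ :=
  if k = 0 then Real.arccos ((a ^ 2 + b ^ 2 - c ^ 2) / (2 * a * b))
  else if k < 0 then
    Real.arccos ((Real.cosh (Real.sqrt (-k) * a) * Real.cosh (Real.sqrt (-k) * b) -
        Real.cosh (Real.sqrt (-k) * c)) /
      (Real.sinh (Real.sqrt (-k) * a) * Real.sinh (Real.sqrt (-k) * b)))
  else
    Real.arccos ((Real.cos (Real.sqrt k * c) -
        Real.cos (Real.sqrt k * a) * Real.cos (Real.sqrt k * b)) /
      (Real.sin (Real.sqrt k * a) * Real.sin (Real.sqrt k * b)))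

/-- A (complete, locally compact) geodesic space has curvature `≥ k` in the sense of
Alexandrov: near every point, comparison angles along pairs of geodesics issuing from a common
point are non-increasing in each of the two parameters. -/
structure CurvBddBelow (M : Type*) [MetricSpace M] (k : ℝ) : Prop where
  locallyCompact : LocallyCompactSpace M
  geodesic : GeodesicSpace M
  comparison : ∀ x : M, ∃ U ∈ 𝓝 x,
    ∀ (p : M) (γ σ : ℝ → M) (L₁ L₂ : ℝ),
      IsUnitGeodesic γ L₁ → IsUnitGeodesic σ L₂ →
      (∀ s ∈ Set.Icc (0:ℝ) L₁, γ s ∈ U) → (∀ t ∈ Set.Icc (0:ℝ) L₂, σ t ∈ U) →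
      γ 0 = p → σ 0 = p →
      ∀ s t s' t' : ℝ, 0 < s → s ≤ s' → s' ≤ L₁ → 0 < t → t ≤ t' → t' ≤ L₂ →
        cmpAngle k s' t' (dist (γ s') (σ t')) ≤ cmpAngle k s t (dist (γ s) (σ t))

/-- An `n`-dimensional Alexandrov space with curvature `≥ k` (without boundary);
its Hausdorff dimension equals `n` and it carries the `n`-dimensional Hausdorff
measure `μH[n]` as its volume. -/
structure AlexandrovSpace (M : Type*) [MetricSpace M] (n : ℕ) (k : ℝ) : Prop where
  curv : CurvBddBelow M k
  dim : dimH (Set.univ : Set M) = n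

/-- An NPC space: a complete geodesic space which is globally non-positively curved in
the sense of Alexandrov (CAT(0)); the comparison inequality `d(P,S) ≤ |P̄S̄|` for the
midpoint `S` of the side `QR` is expressed through the Euclidean median formula. -/
structure NPCSpace (Y : Type*) [MetricSpace Y] : Prop where
  complete : CompleteSpace Y
  geodesic : GeodesicSpace Y
  cat0 : ∀ p q r m : Y, dist q m = dist q r / 2 → dist r m = dist q r / 2 →
    dist p m ^ 2 ≤ (dist p q ^ 2 + dist p r ^ 2) / 2 - dist q r ^ 2 / 4

/-- `Lip_0(Ω)`: Lipschitz functions with compact support contained in `Ω`. -/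
def IsLip0 {M : Type*} [MetricSpace M] (Ω : Set M) (φ : M → ℝ) : Prop :=
  (∃ c : ℝ≥0, LipschitzWith c φ) ∧ IsCompact (tsupport φ) ∧ tsupport φ ⊆ Ω

/-- `C_0(Ω)`: continuous functions with compact support contained in `Ω`. -/
def IsC0 {M : Type*} [MetricSpace M] (Ω : Set M) (φ : M → ℝ) : Prop :=
  Continuous φ ∧ IsCompact (tsupport φ) ∧ tsupport φ ⊆ Ω

/-- `A ⊂⊂ B` : `A` is compactly contained in `B`. -/
def CptIn {M : Type*} [TopologicalSpace M] (A B : Set M) : Prop :=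
  IsCompact (closure A) ∧ closure A ⊆ B

/-- An abstract first-order Sobolev calculus on the metric measure space `(M, d, μ)`:
it records the Sobolev spaces `W^{1,2}(Ω)`, `W^{1,2}_0(Ω)` and the pointwise inner
product of weak gradients `⟨∇f, ∇g⟩`, with the basic compatibility properties. -/
structure SobolevFramework (M : Type*) [MetricSpace M] [MeasurableSpace M]
    (μ : Measure M) where
  memW12 : Set M → (M → ℝ) → Prop
  memW12_0 : Set M → (M → ℝ) → Prop
  innerGrad : (M → ℝ) → (M → ℝ) → M → ℝ
  innerGrad_symm : ∀ f g, innerGrad f g = innerGrad g f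
  innerGrad_add_left : ∀ f g h, innerGrad (f + g) h = innerGrad f h + innerGrad g h
  innerGrad_smul_left : ∀ (c : ℝ) (f g : M → ℝ),
    innerGrad (fun x => c * f x) g = fun x => c * innerGrad f g x
  innerGrad_nonneg : ∀ f x, 0 ≤ innerGrad f f x
  innerGrad_lip_le : ∀ (f : M → ℝ) (c : ℝ≥0), LipschitzWith c f →
    ∀ x, innerGrad f f x ≤ (c : ℝ) ^ 2
  lip_memW12 : ∀ (Ω : Set M) (f : M → ℝ), Bornology.IsBounded Ω →
    (∃ c : ℝ≥0, LipschitzWith c f) → memW12 Ω f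
  lip0_memW12_0 : ∀ (Ω : Set M) (f : M → ℝ), IsLip0 Ω f → memW12_0 Ω f
  memW12_0_sub : ∀ (Ω : Set M) (f : M → ℝ), memW12_0 Ω f → memW12 Ω f

variable {M : Type*} [MetricSpace M] [MeasurableSpace M] {μ : Measure M}

/-- `f ∈ W^{1,2}_loc(Ω)`. -/
def memW12loc (F : SobolevFramework M μ) (Ω : Set M) (f : M → ℝ) : Prop :=
  ∀ Ω' : Set M, IsOpen Ω' → CptIn Ω' Ω → F.memW12 Ω' f

/-- `f` is a super-solution of the Poisson equation `𝓛_f = h·vol` on `Ω`: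
`𝓛_f(φ) = -∫_Ω ⟨∇f,∇φ⟩ ≤ ∫_Ω hφ` for all nonnegative `φ ∈ Lip_0(Ω)`. -/
def IsSupersolution (F : SobolevFramework M μ) (Ω : Set M) (f h : M → ℝ) : Prop :=
  ∀ φ : M → ℝ, IsLip0 Ω φ → (∀ x, 0 ≤ φ x) →
    -∫ x in Ω, F.innerGrad f φ x ∂μ ≤ ∫ x in Ω, h x * φ x ∂μ

/-- `f` is a sub-solution of the Poisson equation `𝓛_f = h·vol` on `Ω`. -/
def IsSubsolution (F : SobolevFramework M μ) (Ω : Set M) (f h : M → ℝ) : Prop :=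
  ∀ φ : M → ℝ, IsLip0 Ω φ → (∀ x, 0 ≤ φ x) →
    ∫ x in Ω, h x * φ x ∂μ ≤ -∫ x in Ω, F.innerGrad f φ x ∂μ

/-- `f` is a weak solution of `𝓛_f = h·vol` on `Ω`. -/
def IsWeakSolution (F : SobolevFramework M μ) (Ω : Set M) (f h : M → ℝ) : Prop :=
  IsSupersolution F Ω f h ∧ IsSubsolution F Ω f h

/-- The normalizing constant `c_{n,p} = ∫_{𝕊^{n-1}} |x¹|^p dσ
    = 2 π^{(n-1)/2} Γ((p+1)/2) / Γ((n+p)/2)`. -/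
def cnp (n : ℕ) (p : ℝ) : ℝ :=
  2 * Real.pi ^ (((n : ℝ) - 1) / 2) * Real.Gamma ((p + 1) / 2) /
    Real.Gamma (((n : ℝ) + p) / 2)

/-- `ω_{n-1}`, the volume of the standard unit sphere `𝕊^{n-1} ⊂ ℝⁿ`. -/
def sphereVol (n : ℕ) : ℝ := 2 * Real.pi ^ ((n : ℝ) / 2) / Real.Gamma ((n : ℝ) / 2)

variable {Y : Type*} [MetricSpace Y]

/-- The approximating energy density
`e^u_{p,ε}(x) = ((n+p)/(c_{n,p} ε^{n+p})) ∫_{B_x(ε)∩Ω} d_Y^p(u(x),u(y)) dμ(y)`. -/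
def ksDensity (n : ℕ) (p : ℝ) (μ : Measure M) (Ω : Set M) (u : M → Y) (ε : ℝ)
    (x : M) : ℝ :=
  ((n : ℝ) + p) / (cnp n p * ε ^ ((n : ℝ) + p)) *
    ∫ y in Metric.ball x ε ∩ Ω, dist (u x) (u y) ^ p ∂μ

/-- The approximating energy `E^u_{p,ε}(φ) = ∫_Ω φ e^u_{p,ε} dμ`. -/
def ksApproxEnergy (n : ℕ) (p : ℝ) (μ : Measure M) (Ω : Set M) (u : M → Y)
    (φ : M → ℝ) (ε : ℝ) : ℝ :=
  ∫ x in Ω, φ x * ksDensity n p μ Ω u ε x ∂μ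

/-- Membership in the Korevaar-Schoen type Sobolev space `W^{1,p}(Ω,Y)`:
`u ∈ L^p(Ω,Y)` is Borel with separable range, the energy functional
`E^u_p(φ) = lim_{ε→0⁺} E^u_{p,ε}(φ)` exists for every `φ ∈ C_0(Ω)`, and the total
energy `sup {E^u_p(φ) : φ ∈ C_0(Ω), 0 ≤ φ ≤ 1}` is finite. -/
def MemKS (n : ℕ) (p : ℝ) (μ : Measure M) (Ω : Set M) (u : M → Y) : Prop :=
  (∀ P : Y, Measurable fun x => dist (u x) P) ∧
  TopologicalSpace.IsSeparable (Set.range u) ∧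
  (∃ P : Y, IntegrableOn (fun x => dist (u x) P ^ p) Ω μ) ∧
  (∀ φ : M → ℝ, IsC0 Ω φ → ∃ e : ℝ,
    Tendsto (fun ε => ksApproxEnergy n p μ Ω u φ ε) (𝓝[>] (0:ℝ)) (𝓝 e)) ∧
  ∃ C : ℝ, ∀ (φ : M → ℝ) (e : ℝ), IsC0 Ω φ → (∀ x, 0 ≤ φ x ∧ φ x ≤ 1) →
    Tendsto (fun ε => ksApproxEnergy n p μ Ω u φ ε) (𝓝[>] (0:ℝ)) (𝓝 e) → e ≤ C

/-- The total energy `E^u_p = sup {E^u_p(φ) : φ ∈ C_0(Ω), 0 ≤ φ ≤ 1}`. -/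
def ksEnergy (n : ℕ) (p : ℝ) (μ : Measure M) (Ω : Set M) (u : M → Y) : ℝ :=
  sSup { e : ℝ | ∃ φ : M → ℝ, IsC0 Ω φ ∧ (∀ x, 0 ≤ φ x ∧ φ x ≤ 1) ∧
    Tendsto (fun ε => ksApproxEnergy n p μ Ω u φ ε) (𝓝[>] (0:ℝ)) (𝓝 e) }

/-- `ν` is the (finite Borel) energy measure `E^u_p` of `u` on `Ω`:
`E^u_{p,ε}(φ) → ∫ φ dν` for every nonnegative `φ ∈ C_0(Ω)`. -/
def IsEnergyMeasure (n : ℕ) (p : ℝ) (μ : Measure M) (Ω : Set M) (u : M → Y)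
    (ν : Measure M) : Prop :=
  IsFiniteMeasure ν ∧
  ∀ φ : M → ℝ, IsC0 Ω φ → (∀ x, 0 ≤ φ x) →
    Tendsto (fun ε => ksApproxEnergy n p μ Ω u φ ε) (𝓝[>] (0:ℝ)) (𝓝 (∫ x, φ x ∂ν))

/-- `|∇u|_p`, the density of the absolutely continuous part of the energy measure `ν`
with respect to `μ` (the Radon–Nikodym derivative). -/
def ksDens (μ ν : Measure M) (x : M) : ℝ := (ν.rnDeriv μ x).toReal

/-- `u` is a harmonic map: `u ∈ W^{1,2}(Ω,Y)` minimizes the energy `E^w_2` among all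
`w ∈ W^{1,2}(Ω,Y)` with `d_Y(w(·),u(·)) ∈ W^{1,2}_0(Ω)`. -/
def IsHarmonicMap (F : SobolevFramework M μ) (n : ℕ) (Ω : Set M) (u : M → Y) : Prop :=
  MemKS n 2 μ Ω u ∧
  ∀ w : M → Y, MemKS n 2 μ Ω w → F.memW12_0 Ω (fun x => dist (w x) (u x)) →
    ksEnergy n 2 μ Ω u ≤ ksEnergy n 2 μ Ω w

/-- The oscillation `osc_A u = max_{x,y ∈ A} d_Y(u(x),u(y))`. -/
def oscOn (u : M → Y) (A : Set M) : ℝ :=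
  sSup { d : ℝ | ∃ x ∈ A, ∃ y ∈ A, d = dist (u x) (u y) }

/-- The pointwise Lipschitz constant `Lip u(x) = limsup_{y→x} d_Y(u(x),u(y))/|xy|`. -/
def pLipMap (u : M → Y) (x : M) : ℝ :=
  Filter.limsup (fun y => dist (u x) (u y) / dist x y) (𝓝[≠] x)

/-- The volume `vol(Σ_x)` of the space of directions at `x`, recovered as
`lim_{r→0⁺} n · vol(B_x(r)) / rⁿ`. -/
def dirVolume (μ : Measure M) (n : ℕ) (x : M) : ℝ :=
  limUnder (𝓝[>] (0:ℝ)) (fun r => (n : ℝ) * (μ (Metric.ball x r)).toReal / r ^ n)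

/-- The model function `s_k`. -/
def snk (k r : ℝ) : ℝ :=
  if k < 0 then Real.sinh (Real.sqrt (-k) * r) / Real.sqrt (-k)
  else if k = 0 then r
  else Real.sin (Real.sqrt k * r) / Real.sqrt k

/-- The set `M^δ = {x : vol(Σ_x) > (1-δ)·vol(𝕊^{n-1})}` of `δ`-regular points. -/
def Mdelta (μ : Measure M) (n : ℕ) (δ : ℝ) : Set M :=
  { x : M | (1 - δ) * sphereVol n < dirVolume μ n x }

/-- The auxiliary function
`f_t(x,λ) = inf_{y∈Ω'} { e^{-2nkλ} |xy|²/(2t) - d_Y(u(x),u(y)) }`. -/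
def auxF (n : ℕ) (k : ℝ) (u : M → Y) (Ω' : Set M) (t : ℝ) (x : M) (l : ℝ) : ℝ :=
  sInf { v : ℝ | ∃ y ∈ Ω',
    v = Real.exp (-2 * (n : ℝ) * k * l) * dist x y ^ 2 / (2 * t) - dist (u x) (u y) }

/-- The set `S_t(x,λ)` of points realizing the infimum defining `f_t(x,λ)`. -/
def auxS (n : ℕ) (k : ℝ) (u : M → Y) (Ω' : Set M) (t : ℝ) (l : ℝ) (x : M) : Set M :=
  { y ∈ Ω' | auxF n k u Ω' t x l
      = Real.exp (-2 * (n : ℝ) * k * l) * dist x y ^ 2 / (2 * t) - dist (u x) (u y) }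

/-- `L_{t,λ}(x) = dist(x, S_t(x,λ))`. -/
def auxL (n : ℕ) (k : ℝ) (u : M → Y) (Ω' : Set M) (t : ℝ) (l : ℝ) (x : M) : ℝ :=
  Metric.infDist x (auxS n k u Ω' t l x)

/-- Distance between two sets. -/
def setDist (A B : Set M) : ℝ := sInf { d : ℝ | ∃ x ∈ A, ∃ y ∈ B, d = dist x y }

/-- `g` is a (weak) super-solution of the heat equation `𝓛_g = ∂g/∂λ` on the parabolic
cylinder `Q = G×I`: `-∫_Q ⟨∇g,∇φ⟩ dν ≤ ∫_Q (∂g/∂λ)φ dν` for all nonnegative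
`φ ∈ Lip_0(Q)`, with `ν = μ × 𝓛¹` and spatial weak gradients. -/
def IsHeatSupersolution (F : SobolevFramework M μ) (G : Set M) (I : Set ℝ)
    (g : M × ℝ → ℝ) : Prop :=
  ∀ φ : M × ℝ → ℝ, IsLip0 (G ×ˢ I) φ → (∀ z, 0 ≤ φ z) →
    -∫ z in G ×ˢ I, F.innerGrad (fun x => g (x, z.2)) (fun x => φ (x, z.2)) z.1
        ∂(μ.prod volume) ≤
      ∫ z in G ×ˢ I, deriv (fun s => g (z.1, s)) z.2 * φ z ∂(μ.prod volume)

/-- `g` is a (weak) sub-solution of the heat equation `𝓛_g = ∂g/∂λ` on `Q = G×I`. -/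
def IsHeatSubsolution (F : SobolevFramework M μ) (G : Set M) (I : Set ℝ)
    (g : M × ℝ → ℝ) : Prop :=
  ∀ φ : M × ℝ → ℝ, IsLip0 (G ×ˢ I) φ → (∀ z, 0 ≤ φ z) →
    ∫ z in G ×ˢ I, deriv (fun s => g (z.1, s)) z.2 * φ z ∂(μ.prod volume) ≤
      -∫ z in G ×ˢ I, F.innerGrad (fun x => g (x, z.2)) (fun x => φ (x, z.2)) z.1
        ∂(μ.prod volume)

/-- `|∇⁺v|(x) = limsup_{r→0} sup_{y∈B_x(r)} (v(y)-v(x))_+ / r`. -/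
def upGrad (v : M → ℝ) (x : M) : ℝ :=
  Filter.limsup
    (fun r => sSup { d : ℝ | ∃ y ∈ Metric.ball x r, d = max (v y - v x) 0 / r })
    (𝓝[>] (0:ℝ))

end Paper

namespace Paper

/-- A continuous midpoint-convex function on `[0, 1]` that is nonpositive at the endpoints is
nonpositive. -/
theorem nonpos_of_midpoint_convex {h : ℝ → ℝ} (hc : ContinuousOn h (Set.Icc 0 1))
    (h0 : h 0 ≤ 0) (h1 : h 1 ≤ 0)
    (hmid : ∀ s ∈ Set.Icc (0:ℝ) 1, ∀ t ∈ Set.Icc (0:ℝ) 1, h ((s + t) / 2) ≤ (h s + h t) / 2)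
    {t : ℝ} (ht : t ∈ Set.Icc (0:ℝ) 1) : h t ≤ 0 := by
  obtain ⟨m, hm, hmax⟩ := isCompact_Icc.exists_isMaxOn ⟨t, ht⟩ hc
  rw [isMaxOn_iff] at hmax
  refine (hmax t ht).trans ?_
  rcases le_total m (1 / 2) with hle | hle
  · have hmem : 2 * m ∈ Set.Icc (0:ℝ) 1 := ⟨by linarith [hm.1], by linarith⟩
    have key := hmid 0 (by simp) (2 * m) hmem
    rw [show (0 + 2 * m) / 2 = m by ring] at key
    linarith [hmax _ hmem]
  · have hmem : 2 * m - 1 ∈ Set.Icc (0:ℝ) 1 := ⟨by linarith, by linarith [hm.2]⟩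
    have key := hmid 1 (by simp) (2 * m - 1) hmem
    rw [show (1 + (2 * m - 1)) / 2 = m by ring] at key
    linarith [hmax _ hmem]

/-- The CAT(0) comparison inequality at an arbitrary point of a geodesic. -/
theorem NPCSpace.exists_comparison_point {Y : Type*} [MetricSpace Y] (hY : NPCSpace Y)
    (x y : Y) {l : ℝ} (hl : l ∈ Set.Icc (0:ℝ) 1) :
    ∃ w : Y, ∀ z : Y, dist z w ^ 2 ≤
      (1 - l) * dist z x ^ 2 + l * dist z y ^ 2 - l * (1 - l) * dist x y ^ 2 := by
  obtain ⟨γ, ⟨-, hγ⟩, hγ0, hγ1⟩ := hY.geodesic x y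
  have hdist : ∀ s ∈ Set.Icc (0:ℝ) 1, ∀ t ∈ Set.Icc (0:ℝ) 1,
      dist (γ (s * dist x y)) (γ (t * dist x y)) = |s - t| * dist x y := by
    have hmem : ∀ s ∈ Set.Icc (0:ℝ) 1, s * dist x y ∈ Set.Icc 0 (dist x y) := fun s hs =>
      ⟨mul_nonneg hs.1 dist_nonneg, mul_le_of_le_one_left dist_nonneg hs.2⟩
    intro s hs t ht
    rw [hγ _ (hmem s hs) _ (hmem t ht), ← sub_mul, abs_mul, abs_of_nonneg (dist_nonneg (x := x))]
  have hcont : ContinuousOn (fun s => γ (s * dist x y)) (Set.Icc (0:ℝ) 1) := by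
    refine LipschitzOnWith.continuousOn (K := nndist x y) ?_
    refine LipschitzOnWith.of_dist_le_mul fun s hs t ht => ?_
    rw [hdist s hs t ht, Real.dist_eq, coe_nndist, mul_comm]
  refine ⟨γ (l * dist x y), fun z => ?_⟩
  have key := nonpos_of_midpoint_convex
    (h := fun s => dist z (γ (s * dist x y)) ^ 2 -
      ((1 - s) * dist z x ^ 2 + s * dist z y ^ 2 - s * (1 - s) * dist x y ^ 2))
    (((continuous_const.dist continuous_id).comp_continuousOn hcont |>.pow 2).sub (by fun_prop)) (by simp [hγ0]) (by simp [hγ1])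
    (fun s hs t ht => ?_) hl
  · simpa using key
  have hm : (s + t) / 2 ∈ Set.Icc (0:ℝ) 1 :=
    ⟨by linarith [hs.1, ht.1], by linarith [hs.2, ht.2]⟩
  have hcat := hY.cat0 z (γ (s * dist x y)) (γ (t * dist x y)) (γ ((s + t) / 2 * dist x y))
    (by rw [hdist s hs _ hm, hdist s hs t ht, show s - (s + t) / 2 = (s - t) / 2 by ring,
          abs_div, abs_two]; ring)
    (by rw [hdist t ht _ hm, hdist s hs t ht, show t - (s + t) / 2 = -((s - t) / 2) by ring,
          abs_neg, abs_div, abs_two]; ring)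
  rw [hdist s hs t ht, mul_pow, sq_abs] at hcat
  linarith

/-- Reshetnyak's quadrilateral inequality. -/
theorem NPCSpace.quadrilateral {Y : Type*} [MetricSpace Y] (hY : NPCSpace Y) (p q r s : Y) :
    dist p r ^ 2 + dist q s ^ 2 ≤
      dist p q ^ 2 + dist r s ^ 2 + 2 * (dist q r * dist p s) := by
  rcases eq_or_ne q r with rfl | hqr
  · simp
  rcases eq_or_ne p s with rfl | hps
  · simp [dist_comm, add_comm]
  have hb : 0 < dist q r := dist_pos.2 hqr
  have hd : 0 < dist p s := dist_pos.2 hps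
  set b := dist q r with hbdef
  set d := dist p s with hddef
  obtain ⟨w, hw⟩ := hY.exists_comparison_point p r (l := d / (b + d))
    ⟨by positivity, (div_le_one (by positivity)).2 (by linarith)⟩
  have hwq := hw q
  have hws := hw s
  rw [dist_comm q p, ← hbdef] at hwq
  rw [dist_comm s p, ← hddef, dist_comm s r, dist_comm s w] at hws
  have hqs : dist q s ^ 2 ≤ (b + d) / b * dist q w ^ 2 + (b + d) / d * dist w s ^ 2 := by
    have htri : dist q s ^ 2 ≤ (dist q w + dist w s) ^ 2 :=
      pow_le_pow_left₀ dist_nonneg (dist_triangle q w s) 2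
    have hid : (b + d) / b * dist q w ^ 2 + (b + d) / d * dist w s ^ 2 =
        (dist q w + dist w s) ^ 2 + (d * dist q w - b * dist w s) ^ 2 / (b * d) := by
      field_simp
      ring
    have hnn : 0 ≤ (d * dist q w - b * dist w s) ^ 2 / (b * d) := by positivity
    linarith
  have h1 := mul_le_mul_of_nonneg_left hwq (show 0 ≤ (b + d) / b by positivity)
  have h2 := mul_le_mul_of_nonneg_left hws (show 0 ≤ (b + d) / d by positivity)
  refine le_of_sub_nonneg ((sub_nonneg.2 (hqs.trans (add_le_add h1 h2))).trans_eq ?_)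
  field_simp
  ring

/-- Lemma 5.2. In an NPC space `Y`, for any ordered four points
`P, Q, R, S` and midpoint `Q_m` of a geodesic from `Q` to `R`:
`(d_{PS} - d_{QR})·d_{QR} ≥ (d²_{PQ_m} - d²_{PQ} - d²_{Q_mQ}) + (d²_{SQ_m} - d²_{SR} - d²_{Q_mR})`. -/
theorem statement_4 {Y : Type*} [MetricSpace Y] (hY : NPCSpace Y)
    (P Q R S Qm : Y)
    (hQ : dist Q Qm = dist Q R / 2) (hR : dist R Qm = dist Q R / 2) :
    (dist P Qm ^ 2 - dist P Q ^ 2 - dist Qm Q ^ 2) +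
      (dist S Qm ^ 2 - dist S R ^ 2 - dist Qm R ^ 2) ≤
    (dist P S - dist Q R) * dist Q R := by
  have hP := hY.cat0 P Q R Qm hQ hR
  have hS := hY.cat0 S Q R Qm hQ hR
  have hquad := hY.quadrilateral P Q R S
  rw [dist_comm S Q, dist_comm S R] at hS
  rw [dist_comm Qm Q, dist_comm Qm R, hQ, hR, dist_comm S R]
  linarith

end Paper
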